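/- arXiv:math/9804136 — 2 statements merged into one kernel-verified Lean document; each statement's English description precedes it below -/
import Mathlib

section
/- Let A ∈ GL(p,ℝ). Let f ∈ C^∞(ℝ^p; ℂ) and suppose that for |ξ| ≥ 1 one has f(ξ) = Σ_{i=1}^N g_i(ξ/|ξ|) |ξ|^{α_i} (log|ξ|)^{l_i} + r(ξ), where g_i ∈ C^∞(S^{p−1}; ℂ), α_i ∈ ℝ, l_i ∈ ℕ, and r is measurable with |r(ξ)| ≤ C (1+|ξ|)^{−p−δ} for some δ > 0. Assume there are a finite set B ⊂ ℝ∖{0}, polynomials (p_β)_{β∈B} and q in one variable, such that ∫_{|ξ|≤R} f(ξ) dξ = q(log R) + Σ_{β∈B} p_β(log R) R^β + o(1) as R → ∞, and likewise a finite set B' ⊂ ℝ∖{0} and polynomials (p'_β)_{β∈B'} and q' with ∫_{|ξ|≤R} f(Aξ) dξ = q'(log R) + Σ_{β∈B'} p'_β(log R) R^β + o(1) as R → ∞. For l ∈ ℕ set h_l := Σ_{i : α_i = −p, l_i = l} g_i. Then q'(0) = |det A|^{−1} ( q(0) + Σ_{l≥0} ((−1)^{l+1}/(l+1)) ∫_{S^{p−1}}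 h_l(ξ) (log|A^{−1}ξ|)^{l+1} dσ(ξ) ), the sum over l being finite. -/
open MeasureTheory Filter
open scoped Classical Topology

noncomputable section

/-- The finite sum `∑ β, P_β (log R) * R ^ β`, for a finitely supported family `P` of polynomials. -/
def logPowerSum (P : ℝ →₀ Polynomial ℂ) (R : ℝ) : ℂ :=
  P.sum fun β p => p.eval ((Real.log R : ℝ) : ℂ) * ((R ^ β : ℝ) : ℂ)

/-- `F` has an asymptotic expansion in powers of `R` and `log R`, up to `o(1)`, with constant
term `c`. -/
def HasConstantTerm (F : ℝ → ℂ) (c : ℂ) : Prop :=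
  ∃ P : ℝ →₀ Polynomial ℂ, (P 0).eval 0 = c ∧
    Tendsto (fun R => F R - logPowerSum P R) atTop (𝓝 0)

lemma logPowerSum_add (P Q : ℝ →₀ Polynomial ℂ) (R : ℝ) :
    logPowerSum (P + Q) R = logPowerSum P R + logPowerSum Q R :=
  Finsupp.sum_add_index' (by simp) (by intros; simp [add_mul])

lemma logPowerSum_sub (P Q : ℝ →₀ Polynomial ℂ) (R : ℝ) :
    logPowerSum (P - Q) R = logPowerSum P R - logPowerSum Q R :=
  Finsupp.sum_sub_index (by intros; simp [sub_mul])

lemma logPowerSum_smul (c : ℂ) (P : ℝ →₀ Polynomial ℂ) (R : ℝ) :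
    logPowerSum (c • P) R = c * logPowerSum P R := by
  unfold logPowerSum
  rw [Finsupp.sum_smul_index' (by simp), Finsupp.mul_sum]
  simp [mul_assoc]

/-- A polynomial in `log R` times a negative power of `R` tends to zero. -/
lemma tendsto_eval_log_mul_rpow (p : Polynomial ℂ) {β : ℝ} (hβ : β < 0) :
    Tendsto (fun R : ℝ => p.eval ((Real.log R : ℝ) : ℂ) * ((R ^ β : ℝ) : ℂ)) atTop (𝓝 0) := by
  have hmono (n : ℕ) :
      Tendsto (fun R : ℝ => (((Real.log R ^ n * R ^ β : ℝ)) : ℂ)) atTop (𝓝 0) := by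
    rw [← Complex.ofReal_zero]
    refine (Complex.continuous_ofReal.tendsto 0).comp ?_
    have h := (isLittleO_log_rpow_rpow_atTop n (neg_pos.2 hβ)).tendsto_div_nhds_zero
    refine h.congr' ?_
    filter_upwards [eventually_gt_atTop 0] with R hR
    rw [Real.rpow_neg hR.le, div_inv_eq_mul, Real.rpow_natCast]
  simp_rw [Polynomial.eval_eq_sum_range, Finset.sum_mul]
  rw [← Finset.sum_const_zero (s := Finset.range (p.natDegree + 1))]
  refine tendsto_finsetSum _ fun n _ => ?_
  simpa [mul_assoc] using (hmono n).const_mul (p.coeff n)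

lemma eq_zero_of_tendsto_eval_log {p : Polynomial ℂ}
    (h : Tendsto (fun R : ℝ => p.eval ((Real.log R : ℝ) : ℂ)) atTop (𝓝 0)) : p = 0 := by
  by_cases hd : 0 < p.degree
  · have hz : Tendsto (fun R : ℝ => ‖((Real.log R : ℝ) : ℂ)‖) atTop atTop := by
      simpa [Function.comp_def] using tendsto_abs_atTop_atTop.comp Real.tendsto_log_atTop
    exact absurd h.norm (not_tendsto_nhds_of_tendsto_atTop (p.tendsto_norm_atTop hd hz) _)
  · rw [Polynomial.eq_C_of_degree_le_zero (not_lt.1 hd)] at h ⊢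
    simp only [Polynomial.eval_C] at h
    rw [tendsto_nhds_unique tendsto_const_nhds h, map_zero]

lemma eq_zero_of_tendsto_sum (s : Finset ℝ) (P : ℝ → Polynomial ℂ)
    (h : Tendsto (fun R : ℝ => ∑ β ∈ s, (P β).eval ((Real.log R : ℝ) : ℂ) * ((R ^ β : ℝ) : ℂ))
      atTop (𝓝 0)) : ∀ β ∈ s, 0 ≤ β → P β = 0 := by
  induction s using Finset.induction_on_max with
  | empty => simp
  | insert a s hs ih =>
    have has : a ∉ s := fun ha => lt_irrefl a (hs a ha)
    by_cases ha : 0 ≤ a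
    · have hPa : P a = 0 := by
        apply eq_zero_of_tendsto_eval_log
        have hneg : Tendsto (fun R : ℝ => ((R ^ (-a) : ℝ) : ℂ) *
            ∑ β ∈ insert a s, (P β).eval ((Real.log R : ℝ) : ℂ) * ((R ^ β : ℝ) : ℂ))
            atTop (𝓝 0) := by
          refine squeeze_zero_norm' ?_ (by simpa using h.norm)
          filter_upwards [eventually_ge_atTop 1] with R hR
          rw [norm_mul]
          refine mul_le_of_le_one_left (norm_nonneg _) ?_
          rw [Complex.norm_real, Real.norm_of_nonneg (by positivity)]
          exact Real.rpow_le_one_of_one_le_of_nonpos hR (by linarith)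
        have hlow : Tendsto (fun R : ℝ => ∑ β ∈ s,
            (P β).eval ((Real.log R : ℝ) : ℂ) * ((R ^ (β - a) : ℝ) : ℂ)) atTop (𝓝 0) := by
          rw [← Finset.sum_const_zero (s := s)]
          exact tendsto_finsetSum _ fun β hβ =>
            tendsto_eval_log_mul_rpow _ (sub_neg.2 (hs β hβ))
        have := hneg.sub hlow
        rw [sub_zero] at this
        refine this.congr' ?_
        filter_upwards [eventually_gt_atTop 0] with R hR
        rw [Finset.sum_insert has, mul_add, Finset.mul_sum, add_sub_assoc,
          ← Finset.sum_sub_distrib]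
        rw [Finset.sum_eq_zero, add_zero, mul_left_comm, ← Complex.ofReal_mul, ← Real.rpow_add hR]
        · simp
        · intro β _
          rw [sub_eq_add_neg β, Real.rpow_add hR, Complex.ofReal_mul]
          ring
      intro β hβ h0
      rcases Finset.mem_insert.1 hβ with rfl | hβ
      · exact hPa
      · exact ih (by simpa [Finset.sum_insert has, hPa] using h) β hβ h0
    · intro β hβ h0
      rcases Finset.mem_insert.1 hβ with rfl | hβ
      · exact absurd h0 ha
      · exact absurd (h0.trans (hs β hβ).le) ha

namespace HasConstantTerm

variable {F G : ℝ → ℂ} {c d : ℂ}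

lemma unique (h : HasConstantTerm F c) (h' : HasConstantTerm F d) : c = d := by
  obtain ⟨P, rfl, hP⟩ := h
  obtain ⟨Q, rfl, hQ⟩ := h'
  have h0 : Tendsto (logPowerSum (P - Q)) atTop (𝓝 0) := by
    simpa [← funext (logPowerSum_sub P Q)] using hQ.sub hP
  have : (P - Q) 0 = 0 := by
    by_contra hne
    exact hne (eq_zero_of_tendsto_sum _ _ h0 0 (Finsupp.mem_support_iff.2 hne) le_rfl)
  rw [sub_eq_zero.1 (show P 0 - Q 0 = 0 by simpa using this)]

lemma add (h : HasConstantTerm F c) (h' : HasConstantTerm G d) :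
    HasConstantTerm (fun R => F R + G R) (c + d) := by
  obtain ⟨P, rfl, hP⟩ := h
  obtain ⟨Q, rfl, hQ⟩ := h'
  refine ⟨P + Q, by simp, ?_⟩
  have := hP.add hQ
  rw [add_zero] at this
  refine this.congr fun R => ?_
  rw [logPowerSum_add]
  ring

lemma const_mul (a : ℂ) (h : HasConstantTerm F c) :
    HasConstantTerm (fun R => a * F R) (a * c) := by
  obtain ⟨P, rfl, hP⟩ := h
  refine ⟨a • P, by simp, ?_⟩
  have := hP.const_mul a
  rw [mul_zero] at this
  refine this.congr fun R => ?_
  rw [logPowerSum_smul, mul_sub]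

lemma of_tendsto_zero (h : Tendsto F atTop (𝓝 0)) : HasConstantTerm F 0 :=
  ⟨0, by simp, by simpa [logPowerSum] using h⟩

lemma congr' (h : HasConstantTerm F c) (hFG : F =ᶠ[atTop] G) : HasConstantTerm G c := by
  obtain ⟨P, hc, hP⟩ := h
  exact ⟨P, hc, hP.congr' (hFG.mono fun R hR => by rw [hR])⟩

lemma eval_log_mul_rpow (p : Polynomial ℂ) (β : ℝ) :
    HasConstantTerm (fun R : ℝ => p.eval ((Real.log R : ℝ) : ℂ) * ((R ^ β : ℝ) : ℂ))
      (if β = 0 then p.eval 0 else 0) := by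
  refine ⟨Finsupp.single β p, ?_, ?_⟩
  · rw [Finsupp.single_apply]
    split_ifs <;> simp
  · simp [logPowerSum]

lemma sum {ι : Type*} (s : Finset ι) {F : ι → ℝ → ℂ} {c : ι → ℂ}
    (h : ∀ i ∈ s, HasConstantTerm (F i) (c i)) :
    HasConstantTerm (fun R => ∑ i ∈ s, F i R) (∑ i ∈ s, c i) := by
  induction s using Finset.induction_on with
  | empty => simpa using of_tendsto_zero tendsto_const_nhds
  | insert a s ha ih =>
    simp only [Finset.sum_insert ha]
    exact (h a (Finset.mem_insert_self a s)).add
      (ih fun i hi => h i (Finset.mem_insert_of_mem hi))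

lemma of_expansion {B : Finset ℝ} (hB : (0 : ℝ) ∉ B) {P : ℝ → Polynomial ℂ}
    {q : Polynomial ℂ} (h : Tendsto (fun R : ℝ => F R - (q.eval ((Real.log R : ℝ) : ℂ)
      + ∑ β ∈ B, (P β).eval ((Real.log R : ℝ) : ℂ) * ((R ^ β : ℝ) : ℂ))) atTop (𝓝 0)) :
    HasConstantTerm F (q.eval 0) := by
  have hsum := sum B fun β _ => eval_log_mul_rpow (P β) β
  rw [Finset.sum_eq_zero fun β hβ => if_neg fun h0 : β = 0 => hB (h0 ▸ hβ)] at hsum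
  have := (of_tendsto_zero h).add ((eval_log_mul_rpow q 0).add hsum)
  simpa using this

end HasConstantTerm

section Annulus

variable {E : Type*} [NormedAddCommGroup E] [NormedSpace ℝ E]

/-- The difference of the indicator functions of the image of the unit ball under `A` and of the
unit ball. -/
def ballDiff (A : E ≃L[ℝ] E) (η : E) : ℝ :=
  (if ‖A.symm η‖ ≤ 1 then 1 else 0) - (if ‖η‖ ≤ 1 then 1 else 0)

lemma norm_ballDiff_le (A : E ≃L[ℝ] E) (η : E) : ‖ballDiff A η‖ ≤ 1 := by
  unfold ballDiff
  split_ifs <;> simp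

/-- `ballDiff A` is supported in an annulus. -/
lemma exists_annulus_of_ballDiff_ne_zero (A : E ≃L[ℝ] E) :
    ∃ c M : ℝ, 0 < c ∧ ∀ η, ballDiff A η ≠ 0 → c ≤ ‖η‖ ∧ ‖η‖ ≤ M := by
  refine ⟨(1 + ‖(A.symm : E →L[ℝ] E)‖)⁻¹, 1 + ‖(A : E →L[ℝ] E)‖, by positivity, ?_⟩
  intro η hη
  have h1 : ‖A.symm η‖ ≤ ‖(A.symm : E →L[ℝ] E)‖ * ‖η‖ := (A.symm : E →L[ℝ] E).le_opNorm η
  have h2 : ‖η‖ ≤ ‖(A : E →L[ℝ] E)‖ * ‖A.symm η‖ := by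
    simpa using (A : E →L[ℝ] E).le_opNorm (A.symm η)
  have hn1 := norm_nonneg (A.symm : E →L[ℝ] E)
  have hn2 := norm_nonneg (A : E →L[ℝ] E)
  contrapose! hη
  unfold ballDiff
  by_cases hc : (1 + ‖(A.symm : E →L[ℝ] E)‖)⁻¹ ≤ ‖η‖
  · have h3 := hη hc
    rw [if_neg, if_neg, sub_zero]
    · intro h
      linarith
    · intro h
      nlinarith
  · rw [not_le, ← one_div, lt_div_iff₀ (by positivity)] at hc
    have h3 := norm_nonneg η
    rw [if_pos, if_pos, sub_self] <;> nlinarith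

/-- The log-homogeneous function of degree `α` and log-degree `l` with angular part `G`. -/
def logHomogeneous (G : E → ℂ) (α : ℝ) (l : ℕ) (ξ : E) : ℂ :=
  G (‖ξ‖⁻¹ • ξ) * ((‖ξ‖ ^ α : ℝ) : ℂ) * ((Real.log ‖ξ‖ ^ l : ℝ) : ℂ)

lemma continuousOn_logHomogeneous {G : E → ℂ} (hG : ContinuousOn G (Metric.sphere 0 1)) (α : ℝ)
    (l : ℕ) : ContinuousOn (logHomogeneous G α l) {0}ᶜ := by
  have hne : ∀ ξ ∈ ({0}ᶜ : Set E), ‖ξ‖ ≠ 0 := fun ξ hξ => norm_ne_zero_iff.2 hξ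
  have h1 : ContinuousOn (fun ξ : E => ‖ξ‖) {0}ᶜ := continuous_norm.continuousOn
  refine ((hG.comp ((h1.inv₀ hne).smul continuousOn_id) ?_).mul
    (Complex.continuous_ofReal.comp_continuousOn (h1.rpow_const fun ξ hξ => Or.inl (hne ξ hξ)))).mul
    (Complex.continuous_ofReal.comp_continuousOn ((h1.log hne).pow l))
  intro ξ hξ
  simp [norm_smul, hne ξ hξ]

lemma logHomogeneous_smul (G : E → ℂ) (α : ℝ) (l : ℕ) {R : ℝ} (hR : 0 < R) {η : E} (hη : η ≠ 0) :
    logHomogeneous G α l (R • η) = ∑ k ∈ Finset.range (l + 1),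
      ((R ^ α : ℝ) : ℂ) * ((Real.log R : ℝ) : ℂ) ^ k * (l.choose k : ℂ)
        * logHomogeneous G α (l - k) η := by
  have hη' : 0 < ‖η‖ := norm_pos_iff.2 hη
  unfold logHomogeneous
  have h1 : ‖R • η‖ = R * ‖η‖ := by rw [norm_smul, Real.norm_of_nonneg hR.le]
  have h2 : (R * ‖η‖)⁻¹ • R • η = ‖η‖⁻¹ • η := by
    rw [smul_smul, mul_inv, mul_right_comm, inv_mul_cancel₀ hR.ne', one_mul]
  rw [h1, h2, Real.mul_rpow hR.le hη'.le, Real.log_mul hR.ne' hη'.ne', add_pow]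
  push_cast
  rw [Finset.mul_sum]
  refine Finset.sum_congr rfl fun k _ => ?_
  ring

variable [MeasurableSpace E] [BorelSpace E]

lemma measurable_ballDiff (A : E ≃L[ℝ] E) : Measurable (ballDiff A) := by
  unfold ballDiff
  refine (Measurable.ite ?_ measurable_const measurable_const).sub
    (Measurable.ite ?_ measurable_const measurable_const)
  · exact measurableSet_le (by fun_prop) measurable_const
  · exact measurableSet_le (by fun_prop) measurable_const

variable [FiniteDimensional ℝ E] (μ : Measure E) [μ.IsAddHaarMeasure]

lemma integrable_ballDiff_smul (A : E ≃L[ℝ] E) {φ : E → ℂ} (hφ : ContinuousOn φ {0}ᶜ) :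
    Integrable (fun η => ballDiff A η • φ η) μ := by
  obtain ⟨c, M, hc, hcM⟩ := exists_annulus_of_ballDiff_ne_zero A
  set K : Set E := Metric.closedBall 0 M \ Metric.ball 0 c with hK
  have hKc : IsCompact K := (isCompact_closedBall 0 M).diff Metric.isOpen_ball
  have hφK : Integrable (K.indicator φ) μ := by
    rw [integrable_indicator_iff hKc.measurableSet]
    refine (hφ.mono ?_).integrableOn_compact hKc
    rintro η hη rfl
    exact hη.2 (by simpa using hc)
  have heq : (fun η => ballDiff A η • φ η) = fun η => ballDiff A η • K.indicator φ η := by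
    funext η
    by_cases h : ballDiff A η = 0
    · simp [h]
    · have := hcM η h
      rw [Set.indicator_of_mem]
      simp [hK, this.1, this.2]
  rw [heq]
  exact hφK.bdd_smul 1 (measurable_ballDiff A).aestronglyMeasurable
    (Eventually.of_forall (norm_ballDiff_le A))

/-- Rescaled comparison of the integrals of `f` and of `f ∘ A` over large balls. -/
lemma integral_closedBall_comp_sub (A : E ≃L[ℝ] E) {f : E → ℂ} (hf : Continuous f) {R : ℝ}
    (hR : 0 < R) :
    ((|(A : E →L[ℝ] E).det| : ℝ) : ℂ) * (∫ ξ in Metric.closedBall (0 : E) R, f (A ξ) ∂μ)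
      = (∫ ξ in Metric.closedBall (0 : E) R, f ξ ∂μ)
        + ((R ^ Module.finrank ℝ E : ℝ) : ℂ) * ∫ η, ballDiff A η • f (R • η) ∂μ := by
  have key (S : Set E) (hS : MeasurableSet S) : ∫ ξ in S, f ξ ∂μ =
      ((R ^ Module.finrank ℝ E : ℝ) : ℂ) *
        ∫ η, (if R • η ∈ S then (1 : ℝ) else 0) • f (R • η) ∂μ := by
    rw [Measure.integral_comp_smul μ (fun η => (if η ∈ S then (1 : ℝ) else 0) • f η) R,
      ← integral_indicator hS, abs_of_pos (by positivity), Complex.real_smul, ← mul_assoc,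
      ← Complex.ofReal_mul, mul_inv_cancel₀ (by positivity), Complex.ofReal_one, one_mul]
    congr 1
    funext η
    simp [Set.indicator_apply]
  have hA : ((|(A : E →L[ℝ] E).det| : ℝ) : ℂ) * (∫ ξ in Metric.closedBall (0 : E) R, f (A ξ) ∂μ)
      = ∫ ξ in A.symm ⁻¹' Metric.closedBall (0 : E) R, f ξ ∂μ := by
    have := integral_image_eq_integral_abs_det_fderiv_smul μ
      (s := Metric.closedBall (0 : E) R) (f := A) (f' := fun _ => (A : E →L[ℝ] E))
      Metric.isClosed_closedBall.measurableSet
      (fun x _ => (A : E →L[ℝ] E).hasFDerivWithinAt) A.injective.injOn f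
    rw [← A.image_eq_preimage_symm, this, integral_smul, Complex.real_smul]
  have hS1 : MeasurableSet (A.symm ⁻¹' Metric.closedBall (0 : E) R) :=
    Metric.isClosed_closedBall.measurableSet.preimage A.symm.continuous.measurable
  rw [hA, key _ hS1, key _ Metric.isClosed_closedBall.measurableSet, ← mul_add]
  congr 1
  have hB : Integrable (fun η => (if R • η ∈ Metric.closedBall (0 : E) R then (1 : ℝ) else 0)
      • f (R • η)) μ := by
    have : IntegrableOn (fun η => f (R • η)) (Metric.closedBall 0 1) μ :=
      (Continuous.continuousOn (by fun_prop)).integrableOn_compact (isCompact_closedBall 0 1)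
    rw [← integrable_indicator_iff Metric.isClosed_closedBall.measurableSet] at this
    refine this.congr (Eventually.of_forall fun η => ?_)
    simp [Set.indicator_apply, norm_smul, abs_of_pos hR, hR]
  rw [← integral_add hB (integrable_ballDiff_smul μ A (Continuous.continuousOn (by fun_prop)))]
  congr 1
  funext η
  rw [← add_smul]
  congr 1
  simp [ballDiff, norm_smul, abs_of_pos hR, hR]

/-- The contribution of a log-homogeneous term to the comparison of integrals over large balls
has a constant term only in degree `-dim E`. -/
lemma hasConstantTerm_logHomogeneous (A : E ≃L[ℝ] E) {G : E → ℂ}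
    (hG : ContinuousOn G (Metric.sphere 0 1)) (α : ℝ) (l : ℕ) :
    HasConstantTerm (fun R => ((R ^ Module.finrank ℝ E : ℝ) : ℂ) *
        ∫ η, ballDiff A η • logHomogeneous G α l (R • η) ∂μ)
      (if α = -(Module.finrank ℝ E : ℝ) then ∫ η, ballDiff A η • logHomogeneous G α l η ∂μ
        else 0) := by
  set I : ℕ → ℂ := fun k => ∫ η, ballDiff A η • logHomogeneous G α k η ∂μ with hI
  set Q : Polynomial ℂ := ∑ k ∈ Finset.range (l + 1),
    Polynomial.C ((l.choose k : ℂ) * I (l - k)) * Polynomial.X ^ k with hQ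
  have hQ0 : Q.eval 0 = I l := by
    simp [hQ, Polynomial.eval_finsetSum, Finset.sum_range_succ']
  have h := HasConstantTerm.eval_log_mul_rpow Q (α + Module.finrank ℝ E)
  rw [hQ0] at h
  simp only [add_eq_zero_iff_eq_neg] at h
  refine h.congr' ?_
  filter_upwards [eventually_gt_atTop 0] with R hR
  have hint : ∫ η, ballDiff A η • logHomogeneous G α l (R • η) ∂μ =
      ∑ k ∈ Finset.range (l + 1), ((R ^ α : ℝ) : ℂ) * ((Real.log R : ℝ) : ℂ) ^ k *
        (l.choose k : ℂ) * I (l - k) := by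
    simp only [hI, ← integral_const_mul]
    rw [← integral_finsetSum]
    · congr 1
      funext η
      by_cases hη : ballDiff A η = 0
      · simp [hη]
      · have hη0 : η ≠ 0 := by
          rintro rfl
          simp [ballDiff] at hη
        rw [logHomogeneous_smul G α l hR hη0, Finset.smul_sum]
        exact Finset.sum_congr rfl fun k _ => (mul_smul_comm _ _ _).symm
    · intro k _
      exact (integrable_ballDiff_smul μ A (continuousOn_logHomogeneous hG α _)).const_mul _
  rw [hint, Real.rpow_add hR, Real.rpow_natCast, hQ, Polynomial.eval_finsetSum, Finset.sum_mul,
    Finset.mul_sum]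
  refine Finset.sum_congr rfl fun k _ => ?_
  simp only [Polynomial.eval_mul, Polynomial.eval_C, Polynomial.eval_pow, Polynomial.eval_X]
  push_cast
  ring

/-- The contribution of an integrable remainder tends to zero. -/
lemma tendsto_integral_ballDiff_remainder (A : E ≃L[ℝ] E) {r : E → ℂ} {C δ : ℝ} (hδ : 0 < δ)
    (hr : ∀ ξ : E, 1 ≤ ‖ξ‖ → ‖r ξ‖ ≤ C * (1 + ‖ξ‖) ^ (-(Module.finrank ℝ E : ℝ) - δ)) :
    Tendsto (fun R : ℝ => ((R ^ Module.finrank ℝ E : ℝ) : ℂ) * ∫ η, ballDiff A η • r (R • η) ∂μ)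
      atTop (𝓝 0) := by
  obtain ⟨c, M, hc, hcM⟩ := exists_annulus_of_ballDiff_ne_zero A
  set n := Module.finrank ℝ E
  set V : ℝ := μ.real (Metric.closedBall (0 : E) M)
  have hlim : Tendsto (fun R : ℝ => |C| * c ^ (-(n : ℝ) - δ) * V * R ^ (-δ)) atTop (𝓝 0) := by
    simpa using (tendsto_rpow_neg_atTop hδ).const_mul (|C| * c ^ (-(n : ℝ) - δ) * V)
  refine squeeze_zero_norm' ?_ hlim
  filter_upwards [eventually_gt_atTop 0, eventually_ge_atTop c⁻¹] with R hR hRc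
  have hbound (η : E) : ‖ballDiff A η • r (R • η)‖ ≤
      (Metric.closedBall (0 : E) M).indicator (fun _ => |C| * (R * c) ^ (-(n : ℝ) - δ)) η := by
    by_cases hη : ballDiff A η = 0
    · rw [hη, zero_smul, norm_zero]
      exact Set.indicator_nonneg (fun _ _ => by positivity) η
    · obtain ⟨h1, h2⟩ := hcM η hη
      rw [Set.indicator_of_mem (by simpa using h2), norm_smul]
      have hn : ‖R • η‖ = R * ‖η‖ := by rw [norm_smul, Real.norm_of_nonneg hR.le]
      have hRη : R * c ≤ ‖R • η‖ := by rw [hn]; gcongr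
      have h1R : 1 ≤ R * c := by
        rw [← inv_mul_cancel₀ hc.ne']
        gcongr
      calc ‖ballDiff A η‖ * ‖r (R • η)‖ ≤ 1 * ‖r (R • η)‖ := by
            gcongr
            exact norm_ballDiff_le A η
        _ ≤ C * (1 + ‖R • η‖) ^ (-(n : ℝ) - δ) := by
            rw [one_mul]
            exact hr _ (h1R.trans hRη)
        _ ≤ |C| * (R * c) ^ (-(n : ℝ) - δ) := by
            gcongr ?_ * ?_
            · exact le_abs_self C
            · refine Real.rpow_le_rpow_of_nonpos (by positivity) (by linarith) ?_
              have : (0 : ℝ) ≤ n := n.cast_nonneg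
              linarith
  have hI : ‖∫ η, ballDiff A η • r (R • η) ∂μ‖ ≤ V * (|C| * (R * c) ^ (-(n : ℝ) - δ)) := by
    refine (norm_integral_le_of_norm_le ?_ (Eventually.of_forall hbound)).trans_eq ?_
    · rw [integrable_indicator_iff Metric.isClosed_closedBall.measurableSet]
      exact integrableOn_const (isCompact_closedBall (0 : E) M).measure_lt_top.ne
    · rw [integral_indicator Metric.isClosed_closedBall.measurableSet, setIntegral_const,
        smul_eq_mul]
  rw [norm_mul, Complex.norm_real, Real.norm_of_nonneg (by positivity)]
  refine (mul_le_mul_of_nonneg_left hI (by positivity)).trans_eq ?_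
  have hpow : (R * c) ^ (-(n : ℝ) - δ) = c ^ (-(n : ℝ) - δ) * (R ^ (-δ) * (R ^ n)⁻¹) := by
    rw [Real.mul_rpow hR.le hc.le, mul_comm, ← Real.rpow_natCast R n, ← Real.rpow_neg hR.le,
      ← Real.rpow_add hR]
    congr 2
    ring
  rw [hpow]
  field_simp

lemma integral_log_pow_div {b : ℝ} (hb : 0 < b) (l : ℕ) :
    ∫ y in (1 : ℝ)..b, Real.log y ^ l / y = Real.log b ^ (l + 1) / (l + 1) := by
  have hpos : ∀ y ∈ Set.uIcc 1 b, 0 < y := fun y hy =>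
    (lt_min one_pos hb).trans_le (Set.mem_Icc.1 hy).1
  rw [intervalIntegral.integral_eq_sub_of_hasDerivAt
    (f := fun y => Real.log y ^ (l + 1) / (l + 1))]
  · simp
  · intro y hy
    have h := ((Real.hasDerivAt_log (hpos y hy).ne').pow (l + 1)).div_const ((l : ℝ) + 1)
    refine h.congr_deriv ?_
    have : (l : ℝ) + 1 ≠ 0 := by positivity
    have := (hpos y hy).ne'
    push_cast
    field_simp
  · refine ContinuousOn.intervalIntegrable fun y hy => ContinuousAt.continuousWithinAt ?_
    have hy0 : y ≠ 0 := (hpos y hy).ne'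
    exact ((Real.continuousAt_log hy0).pow l).div continuousAt_id hy0

/-- The radial integral of a log-homogeneous term of critical degree. -/
lemma integral_Ioi_log_pow {a : ℝ} (ha : 0 < a) (l : ℕ) :
    ∫ y in Set.Ioi (0 : ℝ), ((if y * a ≤ 1 then 1 else 0) - (if y ≤ 1 then 1 else 0)) *
      (Real.log y ^ l / y) = (-1) ^ (l + 1) / (l + 1) * Real.log a ^ (l + 1) := by
  have hb : 0 < a⁻¹ := inv_pos.2 ha
  have hint (u v : ℝ) (hu : 0 < u) :
      Integrable ((Set.Ioc u v).indicator fun y => Real.log y ^ l / y) := by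
    rw [integrable_indicator_iff measurableSet_Ioc]
    refine (ContinuousOn.integrableOn_compact isCompact_Icc fun y hy => ?_).mono_set
      Set.Ioc_subset_Icc_self
    have hy0 : y ≠ 0 := (hu.trans_le hy.1).ne'
    exact (((Real.continuousAt_log hy0).pow l).div continuousAt_id hy0).continuousWithinAt
  have heq (y : ℝ) : (Set.Ioi (0 : ℝ)).indicator
      (fun y => ((if y * a ≤ 1 then 1 else 0) - (if y ≤ 1 then 1 else 0)) *
        (Real.log y ^ l / y)) y =
      (Set.Ioc 1 a⁻¹).indicator (fun y => Real.log y ^ l / y) y -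
        (Set.Ioc a⁻¹ 1).indicator (fun y => Real.log y ^ l / y) y := by
    have hya : y * a ≤ 1 ↔ y ≤ a⁻¹ := by rw [← one_div, le_div_iff₀ ha]
    simp only [Set.indicator_apply, Set.mem_Ioi, Set.mem_Ioc, hya]
    by_cases h0 : 0 < y
    · by_cases h1 : y ≤ 1 <;> by_cases h2 : y ≤ a⁻¹ <;> simp [h0, h1, h2, not_lt.2, not_le.1]
    · have h1 : ¬ 1 < y := fun h => h0 (one_pos.trans h)
      have h2 : ¬ a⁻¹ < y := fun h => h0 (hb.trans h)
      simp [h0, h1, h2]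
  rw [← integral_indicator measurableSet_Ioi, integral_congr_ae (Eventually.of_forall heq),
    integral_sub (hint _ _ one_pos) (hint _ _ hb), integral_indicator measurableSet_Ioc,
    integral_indicator measurableSet_Ioc]
  refine (integral_log_pow_div hb l).trans ?_
  rw [Real.log_inv, neg_pow]
  ring

lemma integral_volumeIoiPow (n : ℕ) (F : ℝ → ℂ) :
    ∫ y : Set.Ioi (0 : ℝ), F y ∂(Measure.volumeIoiPow n) =
      ∫ y in Set.Ioi (0 : ℝ), y ^ n • F y := by
  simp only [Measure.volumeIoiPow, ENNReal.ofReal]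
  rw [integral_withDensity_eq_integral_smul,
    integral_subtype_comap measurableSet_Ioi fun a => Real.toNNReal (a ^ n) • F a,
    setIntegral_congr_fun measurableSet_Ioi fun x hx => ?_]
  · rw [NNReal.smul_def, Real.coe_toNNReal _ (pow_nonneg hx.out.le _)]
  · exact (measurable_subtype_coe.pow_const _).real_toNNReal

/-- Integration in polar coordinates. -/
lemma integral_eq_integral_toSphere [Nontrivial E] {F : E → ℂ} (hF : Integrable F μ) :
    ∫ η, F η ∂μ = ∫ ω : Metric.sphere (0 : E) 1, ∫ y in Set.Ioi (0 : ℝ),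
      y ^ (Module.finrank ℝ E - 1) • F (y • (ω : E)) ∂volume ∂μ.toSphere := by
  have hmp := μ.measurePreserving_homeomorphUnitSphereProd
  have hemb := (homeomorphUnitSphereProd E).measurableEmbedding
  set Φ : Metric.sphere (0 : E) 1 × Set.Ioi (0 : ℝ) → ℂ := fun x => F ((x.2 : ℝ) • (x.1 : E))
  have hcomp : Φ ∘ homeomorphUnitSphereProd E = fun x : ({0}ᶜ : Set E) => F x := by
    funext x
    have hx : ‖(x : E)‖ ≠ 0 := norm_ne_zero_iff.2 x.2
    simp [Φ, smul_smul, mul_inv_cancel₀ hx]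
  have hΦ : Integrable Φ (μ.toSphere.prod (.volumeIoiPow (Module.finrank ℝ E - 1))) := by
    rw [← hmp.integrable_comp_emb hemb, hcomp]
    exact (integrableOn_iff_comap_subtypeVal (measurableSet_singleton _).compl).1 hF.integrableOn
  calc ∫ η, F η ∂μ = ∫ x : ({0}ᶜ : Set E), F x ∂(μ.comap (↑)) := by
        rw [integral_subtype_comap (measurableSet_singleton _).compl F, restrict_compl_singleton]
    _ = ∫ x, Φ x ∂μ.toSphere.prod (.volumeIoiPow (Module.finrank ℝ E - 1)) := by
        rw [← hmp.integral_comp hemb]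
        exact integral_congr_ae (Eventually.of_forall fun x => (congrFun hcomp x).symm)
    _ = _ := by
        rw [integral_prod _ hΦ]
        refine integral_congr_ae (Eventually.of_forall fun ω => ?_)
        exact integral_volumeIoiPow _ fun y => F (y • (ω : E))

/-- The constant produced by a log-homogeneous term of critical degree. -/
lemma integral_ballDiff_logHomogeneous [Nontrivial E] (A : E ≃L[ℝ] E) {G : E → ℂ}
    (hG : ContinuousOn G (Metric.sphere 0 1)) (l : ℕ) :
    ∫ η, ballDiff A η • logHomogeneous G (-(Module.finrank ℝ E : ℝ)) l η ∂μ =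
      ((-1 : ℂ) ^ (l + 1) / (l + 1)) * ∫ ω : Metric.sphere (0 : E) 1,
        G ω * ((Real.log ‖A.symm (ω : E)‖ ^ (l + 1) : ℝ) : ℂ) ∂μ.toSphere := by
  rw [integral_eq_integral_toSphere μ
    (integrable_ballDiff_smul μ A (continuousOn_logHomogeneous hG _ l)), ← integral_const_mul]
  refine integral_congr_ae (Eventually.of_forall fun ω => ?_)
  have hω : ‖(ω : E)‖ = 1 := by simp
  have hω0 : (ω : E) ≠ 0 := norm_ne_zero_iff.1 (by simp)
  have ha : 0 < ‖A.symm (ω : E)‖ := norm_pos_iff.2 (by simpa using hω0)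
  have hrad : ∀ y ∈ Set.Ioi (0 : ℝ), y ^ (Module.finrank ℝ E - 1) •
      ballDiff A (y • (ω : E)) • logHomogeneous G (-(Module.finrank ℝ E : ℝ)) l (y • (ω : E)) =
      G ω * (((((if y * ‖A.symm (ω : E)‖ ≤ 1 then 1 else 0) - (if y ≤ 1 then 1 else 0)) *
        (Real.log y ^ l / y) : ℝ)) : ℂ) := by
    intro y hy
    have hy0 : 0 < y := hy
    have hny : ‖y • (ω : E)‖ = y := by rw [norm_smul, hω, mul_one, Real.norm_of_nonneg hy0.le]
    have hAy : ‖A.symm (y • (ω : E))‖ = y * ‖A.symm (ω : E)‖ := by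
      rw [map_smul, norm_smul, Real.norm_of_nonneg hy0.le]
    have hdir : y⁻¹ • y • (ω : E) = ω := inv_smul_smul₀ hy0.ne' _
    have hpow : y ^ (Module.finrank ℝ E - 1) * y ^ (-(Module.finrank ℝ E : ℝ)) = y⁻¹ := by
      obtain ⟨m, hm⟩ := Nat.exists_eq_succ_of_ne_zero (Module.finrank_pos (R := ℝ) (M := E)).ne'
      rw [Real.rpow_neg hy0.le, Real.rpow_natCast, hm, Nat.succ_sub_one, pow_succ]
      field_simp
    unfold ballDiff logHomogeneous
    rw [hny, hAy, hdir, div_eq_mul_inv, ← hpow, Complex.real_smul, Complex.real_smul]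
    push_cast
    ring
  dsimp only
  rw [setIntegral_congr_fun measurableSet_Ioi hrad, integral_const_mul, integral_complex_ofReal,
    integral_Ioi_log_pow ha]
  push_cast
  ring

end Annulus

/-- change of variables for the regularized integral.  Let
`A ∈ GL(p,ℝ)` and let `f` be smooth with a log-polyhomogeneous expansion
`f(ξ) = Σᵢ gᵢ(ξ/|ξ|)|ξ|^{αᵢ} log^{lᵢ}|ξ| + O(|ξ|^{-p-δ})` at infinity; assume
`∫_{|ξ|≤R} f(ξ)dξ` and `∫_{|ξ|≤R} f(Aξ)dξ` admit asymptotic expansions in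
powers of `R` and `log R`, with constant terms `q(0)`, `q'(0)`.  With
`h_l := Σ_{i : αᵢ = -p, lᵢ = l} gᵢ` one has
`q'(0) = |det A|⁻¹ (q(0) + Σ_l ((-1)^{l+1}/(l+1)) ∫_{S^{p-1}} h_l(ξ) (log|A⁻¹ξ|)^{l+1} dσ(ξ))`. -/
theorem stmt_8 (p : ℕ) (hp : 1 ≤ p)
    (A : EuclideanSpace ℝ (Fin p) ≃L[ℝ] EuclideanSpace ℝ (Fin p))
    (f : EuclideanSpace ℝ (Fin p) → ℂ) (hf : ContDiff ℝ (⊤ : ℕ∞) f)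
    (N : ℕ) (g : Fin N → EuclideanSpace ℝ (Fin p) → ℂ)
    (hg : ∀ i, ContDiffOn ℝ (⊤ : ℕ∞) (g i) (Metric.sphere 0 1))
    (α : Fin N → ℝ) (l : Fin N → ℕ)
    (r : EuclideanSpace ℝ (Fin p) → ℂ) (hr_meas : Measurable r)
    (C δ : ℝ) (hδ : 0 < δ)
    (hr_bound : ∀ ξ : EuclideanSpace ℝ (Fin p), 1 ≤ ‖ξ‖ →
      ‖r ξ‖ ≤ C * (1 + ‖ξ‖) ^ (-(p : ℝ) - δ))
    (hexp : ∀ ξ : EuclideanSpace ℝ (Fin p), 1 ≤ ‖ξ‖ →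
      f ξ = ∑ i, g i (‖ξ‖⁻¹ • ξ) * ((‖ξ‖ ^ α i : ℝ) : ℂ)
          * ((Real.log ‖ξ‖ ^ l i : ℝ) : ℂ) + r ξ)
    (B : Finset ℝ) (hB : (0 : ℝ) ∉ B) (P : ℝ → Polynomial ℂ) (q : Polynomial ℂ)
    (hasym : Tendsto (fun R : ℝ =>
        (∫ ξ in Metric.closedBall (0 : EuclideanSpace ℝ (Fin p)) R, f ξ)
        - (q.eval ((Real.log R : ℝ) : ℂ)
          + ∑ β ∈ B, (P β).eval ((Real.log R : ℝ) : ℂ) * ((R ^ β : ℝ) : ℂ)))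
      atTop (𝓝 0))
    (B' : Finset ℝ) (hB' : (0 : ℝ) ∉ B') (P' : ℝ → Polynomial ℂ)
    (q' : Polynomial ℂ)
    (hasym' : Tendsto (fun R : ℝ =>
        (∫ ξ in Metric.closedBall (0 : EuclideanSpace ℝ (Fin p)) R, f (A ξ))
        - (q'.eval ((Real.log R : ℝ) : ℂ)
          + ∑ β ∈ B', (P' β).eval ((Real.log R : ℝ) : ℂ) * ((R ^ β : ℝ) : ℂ)))
      atTop (𝓝 0)) :
    q'.eval 0 = ((|(A : EuclideanSpace ℝ (Fin p) →L[ℝ] EuclideanSpace ℝ (Fin p)).det|⁻¹ : ℝ) : ℂ)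
      * (q.eval 0 + ∑ l' ∈ Finset.range ((Finset.univ.sup l) + 1),
          ((-1 : ℂ) ^ (l' + 1) / (l' + 1)) *
          ∫ ω : Metric.sphere (0 : EuclideanSpace ℝ (Fin p)) 1,
            (∑ i ∈ Finset.univ.filter (fun i => α i = -(p : ℝ) ∧ l i = l'),
              g i ω)
            * ((Real.log ‖A.symm (ω : EuclideanSpace ℝ (Fin p))‖ ^ (l' + 1) : ℝ) : ℂ)
          ∂((volume : Measure (EuclideanSpace ℝ (Fin p))).toSphere)) := by
  have : NeZero p := ⟨Nat.one_le_iff_ne_zero.1 hp⟩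
  have hfin : Module.finrank ℝ (EuclideanSpace ℝ (Fin p)) = p := finrank_euclideanSpace_fin
  have hgc (i : Fin N) : ContinuousOn (g i) (Metric.sphere 0 1) := (hg i).continuousOn
  have hdet : (A : EuclideanSpace ℝ (Fin p) →L[ℝ] EuclideanSpace ℝ (Fin p)).det ≠ 0 :=
    A.toLinearEquiv.isUnit_det'.ne_zero
  set D : ℝ := |(A : EuclideanSpace ℝ (Fin p) →L[ℝ] EuclideanSpace ℝ (Fin p)).det|
  have hD : (D : ℂ) ≠ 0 := Complex.ofReal_ne_zero.2 (abs_ne_zero.2 hdet)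
  have hcrit (i : Fin N) := hasConstantTerm_logHomogeneous volume A (hgc i) (α i) (l i)
  have hrem := tendsto_integral_ballDiff_remainder volume A hδ
    (by simpa only [hfin] using hr_bound)
  have hsum := ((HasConstantTerm.of_expansion hB hasym).add
    ((HasConstantTerm.sum Finset.univ fun i _ => hcrit i).add
      (HasConstantTerm.of_tendsto_zero hrem)))
  have heq : (D : ℂ) * q'.eval 0 = _ :=
    ((HasConstantTerm.of_expansion hB' hasym').const_mul (D : ℂ)).unique <| hsum.congr' <| by
      obtain ⟨c, M, hc, hcM⟩ := exists_annulus_of_ballDiff_ne_zero A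
      filter_upwards [eventually_gt_atTop 0, eventually_ge_atTop c⁻¹] with R hR hRc
      rw [integral_closedBall_comp_sub volume A hf.continuous hR, ← Finset.mul_sum, ← mul_add]
      congr 2
      have hsmul (i : Fin N) : Integrable (fun η =>
          ballDiff A η • logHomogeneous (g i) (α i) (l i) (R • η)) := by
        refine integrable_ballDiff_smul volume A
          ((continuousOn_logHomogeneous (hgc i) (α i) (l i)).comp
            (continuous_const_smul R).continuousOn ?_)
        intro η hη
        exact smul_ne_zero hR.ne' hη
      have hsmulf : Integrable (fun η => ballDiff A η • f (R • η)) :=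
        integrable_ballDiff_smul volume A
          (hf.continuous.comp (continuous_const_smul R)).continuousOn
      have hr_eq (η : EuclideanSpace ℝ (Fin p)) : ballDiff A η • r (R • η) =
          ballDiff A η • f (R • η)
            - ∑ i, ballDiff A η • logHomogeneous (g i) (α i) (l i) (R • η) := by
        by_cases hη : ballDiff A η = 0
        · simp [hη]
        · have h1 : 1 ≤ ‖R • η‖ := by
            rw [norm_smul, Real.norm_of_nonneg hR.le, ← inv_mul_cancel₀ hc.ne']
            exact mul_le_mul hRc (hcM η hη).1 hc.le hR.le
          rw [← Finset.smul_sum, ← smul_sub, hexp _ h1]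
          congr 1
          exact (add_sub_cancel_left _ _).symm
      rw [integral_congr_ae (Eventually.of_forall hr_eq),
        integral_sub hsmulf (integrable_finsetSum _ fun i _ => hsmul i),
        integral_finsetSum _ fun i _ => hsmul i]
      ring
  have hsphere : (∑ i, if α i = -(Module.finrank ℝ (EuclideanSpace ℝ (Fin p)) : ℝ) then
        ∫ η, ballDiff A η • logHomogeneous (g i) (α i) (l i) η else 0) =
      ∑ l' ∈ Finset.range ((Finset.univ.sup l) + 1),
          ((-1 : ℂ) ^ (l' + 1) / (l' + 1)) *
          ∫ ω : Metric.sphere (0 : EuclideanSpace ℝ (Fin p)) 1,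
            (∑ i ∈ Finset.univ.filter (fun i => α i = -(p : ℝ) ∧ l i = l'),
              g i ω)
            * ((Real.log ‖A.symm (ω : EuclideanSpace ℝ (Fin p))‖ ^ (l' + 1) : ℝ) : ℂ)
          ∂((volume : Measure (EuclideanSpace ℝ (Fin p))).toSphere) := by
    have hint (i : Fin N) (k : ℕ) : Integrable
        (fun ω : Metric.sphere (0 : EuclideanSpace ℝ (Fin p)) 1 =>
          g i ω * ((Real.log ‖A.symm (ω : EuclideanSpace ℝ (Fin p))‖ ^ k : ℝ) : ℂ))
        (volume : Measure (EuclideanSpace ℝ (Fin p))).toSphere := by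
      refine Continuous.integrable_of_hasCompactSupport ?_ (HasCompactSupport.of_compactSpace _)
      have hlog : Continuous fun ω : Metric.sphere (0 : EuclideanSpace ℝ (Fin p)) 1 =>
          Real.log ‖A.symm (ω : EuclideanSpace ℝ (Fin p))‖ := by
        refine Continuous.log (by fun_prop) fun ω => ?_
        have hω0 : (ω : EuclideanSpace ℝ (Fin p)) ≠ 0 := norm_ne_zero_iff.1 (by simp)
        simpa using hω0
      exact (continuousOn_iff_continuous_domRestrict.1 (hgc i)).mul
        (Complex.continuous_ofReal.comp (hlog.pow k))
    simp_rw [Finset.sum_mul]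
    simp_rw [integral_finsetSum _ fun i _ => hint i _, Finset.mul_sum, Finset.sum_filter]
    rw [Finset.sum_comm]
    refine Finset.sum_congr rfl fun i _ => ?_
    rw [Finset.sum_eq_single (l i)]
    · by_cases hα : α i = -(p : ℝ)
      · rw [if_pos (by rw [hfin, hα]), if_pos ⟨hα, rfl⟩, hα]
        have h := integral_ballDiff_logHomogeneous volume A (hgc i) (l i)
        rwa [hfin] at h
      · rw [if_neg (by rwa [hfin]), if_neg fun h => hα h.1]
    · intro k _ hk
      exact if_neg fun h => hk h.2.symm
    · intro h
      exact absurd (Finset.mem_range_succ_iff.2 (Finset.le_sup (Finset.mem_univ i))) h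
  rw [hsphere, add_zero] at heq
  rw [← heq, Complex.ofReal_inv, inv_mul_cancel_left₀ hD]
end
end

section
/- For x = (x_0, x_1, …, x_p) ∈ ℝ^{p+1} with x ≠ 0, the matrix f(x) := x_0·I + Σ_{j=1}^p x_j E_j is invertible, and for every j ∈ {0,1,…,p} the following holds: let (i_1 < i_2 < … < i_p) be the increasing enumeration of {0,1,…,p}∖{j}, and set D_0 := I and D_i := E_i for 1 ≤ i ≤ p. Then Σ_{σ ∈ S_p} sgn(σ) · tr( f(x)^{−1} D_{i_{σ(1)}} · f(x)^{−1} D_{i_{σ(2)}} · … · f(x)^{−1} D_{i_{σ(p)}} ) = (−1)^j x_j |x|^{−p−1} · p! · tr(E_1 E_2 ⋯ E_p), where |x|² = Σ_{j=0}^p x_j². (Equivalently: the p-form tr((f^{−1}df)^p) on ℝ^{p+1}∖{0} equals |x|^{−p−1} p! tr(E_1⋯E_p) Σ_{j=0}^p (−1)^j x_j dx_0 ∧ … ∧ \widehat{dx_j} ∧ … ∧ dx_p.) -/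
open Matrix

section OrderedProducts

variable {A : Type*} [Ring A]

/-- If two tuples agree away from two adjacent positions, where their products are opposite, then
their ordered products are opposite. -/
theorem prod_ofFn_eq_neg_of_adjacent {n : ℕ} (X Y : Fin (n + 1) → A) (i : Fin n)
    (hne : ∀ a, a ≠ i.castSucc → a ≠ i.succ → X a = Y a)
    (hmul : X i.castSucc * X i.succ = -(Y i.castSucc * Y i.succ)) :
    (List.ofFn X).prod = -(List.ofFn Y).prod := by
  induction n with
  | zero => exact i.elim0
  | succ n ih =>
    cases i using Fin.cases with
    | zero =>
      have htail : (fun a : Fin n => X a.succ.succ) = fun a => Y a.succ.succ := by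
        funext a
        exact hne _ (Fin.succ_ne_zero _) fun h => Fin.succ_ne_zero a (Fin.succ_injective _ h)
      have hmul' : X 0 * X (Fin.succ 0) = -(Y 0 * Y (Fin.succ 0)) := hmul
      simp only [List.ofFn_succ, List.prod_cons, htail]
      rw [← mul_assoc, hmul', neg_mul, mul_assoc]
    | succ i =>
      have h0 : X 0 = Y 0 := hne 0 (Fin.succ_ne_zero i.castSucc).symm (Fin.succ_ne_zero _).symm
      have htail := ih (fun a => X a.succ) (fun a => Y a.succ) i
        (fun a h₁ h₂ => hne a.succ (fun h => h₁ (Fin.succ_injective _ h))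
          fun h => h₂ (Fin.succ_injective _ h)) hmul
      rw [List.ofFn_succ (f := X), List.ofFn_succ (f := Y), List.prod_cons, List.prod_cons, htail,
        h0, mul_neg]

/-- An ordered product whose adjacent factors change sign when their labels are exchanged is
antisymmetric in its labels. -/
theorem prod_ofFn_perm {n : ℕ} (G : Fin n → Fin n → A)
    (hG : ∀ i j : Fin n, (i : ℕ) + 1 = j → ∀ a b, a ≠ b → G i a * G j b = -(G i b * G j a))
    (σ : Equiv.Perm (Fin n)) :
    (List.ofFn fun i => G i (σ i)).prod = Equiv.Perm.sign σ • (List.ofFn fun i => G i i).prod := by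
  cases n with
  | zero => simp [Subsingleton.elim σ 1]
  | succ n =>
    have hσ : σ ∈ Submonoid.closure
        (Set.range fun i : Fin n => Equiv.swap i.castSucc i.succ) := by
      rw [Equiv.Perm.mclosure_swap_castSucc_succ]
      exact Submonoid.mem_top σ
    induction hσ using Submonoid.closure_induction_right with
    | one => simp
    | mul_right σ _ τ hτ ih =>
      obtain ⟨i, rfl⟩ := hτ
      have hi : i.castSucc ≠ i.succ := Fin.castSucc_lt_succ.ne
      rw [prod_ofFn_eq_neg_of_adjacent (fun a => G a ((σ * Equiv.swap i.castSucc i.succ) a))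
        (fun a => G a (σ a)) i
        (fun a h₁ h₂ => by simp [Equiv.swap_apply_of_ne_of_ne h₁ h₂])
        (by
          simpa using hG i.castSucc i.succ (by simp) (σ i.succ) (σ i.castSucc)
            (σ.injective.ne hi.symm)), ih]
      simp [Equiv.Perm.sign_swap hi]

/-- Moving an element past an ordered product collects the commutation signs. -/
theorem mul_prod_ofFn_eq_sign_smul {n : ℕ} (B : A) (X : Fin n → A) (ε : Fin n → ℤ)
    (h : ∀ a, B * X a = ε a • (X a * B)) :
    B * (List.ofFn X).prod = (∏ a, ε a) • ((List.ofFn X).prod * B) := by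
  induction n with
  | zero => simp
  | succ n ih =>
    rw [List.ofFn_succ, List.prod_cons, ← mul_assoc, h, smul_mul_assoc, mul_assoc,
      ih (fun a => X a.succ) (fun a => ε a.succ) (fun a => h a.succ), Fin.prod_univ_succ,
      mul_smul_comm, smul_smul, mul_assoc]

theorem prod_ofFn_neg_one_pow {m : ℕ} (X : Fin (2 * m + 1) → A) :
    (List.ofFn fun i => (-1) ^ (i : ℕ) * X i).prod = (-1) ^ m * (List.ofFn X).prod := by
  induction m with
  | zero => simp
  | succ m ih =>
    have key := ih fun i => X i.succ.succ
    change (List.ofFn (n := 2 * m + 1 + 1 + 1) fun i => (-1) ^ (i : ℕ) * X i).prod =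
      (-1) ^ (m + 1) * (List.ofFn (n := 2 * m + 1 + 1 + 1) X).prod
    simp only [List.ofFn_succ (n := 2 * m + 1 + 1), List.ofFn_succ (n := 2 * m + 1),
      List.prod_cons, Fin.val_succ, Fin.val_zero, pow_succ _ (Fin.val _)]
    simp only [mul_neg, mul_one, neg_neg, key]
    rcases neg_one_pow_eq_or A m with h | h <;> simp [h, pow_succ]

end OrderedProducts

section CliffordPairs

variable {V : Type*} [NormedAddCommGroup V] [InnerProductSpace ℝ V]
variable {A : Type*} [Ring A] [Algebra ℝ A]

/-- Two linear maps `c, c'` such that `c' v * c v` and `c v * c' v` are both `‖v‖²`, in polarized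
form. -/
structure IsCliffordPair (c c' : V →ₗ[ℝ] A) : Prop where
  conj_mul : ∀ v w, c' v * c w + c' w * c v = (2 * inner ℝ v w) • (1 : A)
  mul_conj : ∀ v w, c v * c' w + c w * c' v = (2 * inner ℝ v w) • (1 : A)

namespace IsCliffordPair

variable {c c' : V →ₗ[ℝ] A}

theorem symm (h : IsCliffordPair c c') : IsCliffordPair c' c := ⟨h.mul_conj, h.conj_mul⟩

theorem conj_mul_self (h : IsCliffordPair c c')
    (v : V) : c' v * c v = inner ℝ v v • (1 : A) := by
  have := h.conj_mul v v
  rw [← two_smul ℝ, mul_smul] at this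
  exact smul_right_injective A (two_ne_zero (α := ℝ)) this

theorem conj_mul_of_inner_eq_zero (h : IsCliffordPair c c')
    {v w : V} (hvw : inner ℝ v w = 0) :
    c' v * c w = -(c' w * c v) := by
  rw [eq_neg_iff_add_eq_zero, h.conj_mul, hvw, mul_zero, zero_smul]

theorem mul_mul_of_inner_eq_zero (h : IsCliffordPair c c')
    {x w : V} (v : V) (hw : inner ℝ x w = 0) :
    c' x * c v * (c' x * c w) = -(c' x * (c v * c' w) * c x) := by
  rw [h.conj_mul_of_inner_eq_zero hw]
  noncomm_ring

theorem mul_self_of_inner_eq_zero (h : IsCliffordPair c c')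
    {x v : V} (hv : inner ℝ x v = 0) :
    c' x * c v * (c' x * c v) = -(inner ℝ v v * inner ℝ x x) • (1 : A) := by
  rw [h.mul_mul_of_inner_eq_zero v hv, h.symm.conj_mul_self, mul_smul_comm, smul_mul_assoc, mul_one,
    h.conj_mul_self, smul_smul, neg_smul]

theorem anticomm_of_inner_eq_zero (h : IsCliffordPair c c')
    {x v w : V} (hv : inner ℝ x v = 0) (hw : inner ℝ x w = 0)
    (hvw : inner ℝ v w = 0) :
    c' x * c v * (c' x * c w) = -(c' x * c w * (c' x * c v)) := by
  rw [h.mul_mul_of_inner_eq_zero v hw, h.mul_mul_of_inner_eq_zero w hv,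
    h.symm.conj_mul_of_inner_eq_zero hvw]
  simp

end IsCliffordPair

/-- The maps `c', c, c', c, …`. -/
def cliffordAlternate (c c' : V →ₗ[ℝ] A) (i : ℕ) : V →ₗ[ℝ] A := if Even i then c' else c

namespace IsCliffordPair

variable {c c' : V →ₗ[ℝ] A}

theorem alternate_mul (h : IsCliffordPair c c')
    {v w : V} (hvw : inner ℝ v w = 0) (i : ℕ) :
    cliffordAlternate c c' i v * cliffordAlternate c c' (i + 1) w =
      -(cliffordAlternate c c' i w * cliffordAlternate c c' (i + 1) v) := by
  by_cases hi : Even i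
  · simpa [cliffordAlternate, hi, Nat.even_add_one] using h.conj_mul_of_inner_eq_zero hvw
  · simpa [cliffordAlternate, hi, Nat.even_add_one] using h.symm.conj_mul_of_inner_eq_zero hvw

/-- The product `c' w₀ * c w₁ * c' w₂ * ⋯` of an orthogonal family is its determinant times the
product for an orthonormal basis. -/
theorem prod_alternate_eq_det_smul (h : IsCliffordPair c c')
    {n : ℕ} (e : OrthonormalBasis (Fin n) ℝ V) (w : Fin n → V)
    (hw : Pairwise fun a b => inner ℝ (w a) (w b) = 0) :
    (List.ofFn fun i : Fin n => cliffordAlternate c c' i (w i)).prod =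
      e.toBasis.det w • (List.ofFn fun i : Fin n => cliffordAlternate c c' i (e i)).prod := by
  let P : MultilinearMap ℝ (fun _ : Fin n => V) A :=
    (MultilinearMap.mkPiAlgebraFin ℝ n A).compLinearMap fun i => cliffordAlternate c c' i
  have hP : ∀ w : Fin n → V, (Pairwise fun a b => inner ℝ (w a) (w b) = 0) →
      MultilinearMap.alternatization P w =
        (n.factorial : ℝ) • (List.ofFn fun i : Fin n => cliffordAlternate c c' i (w i)).prod := by
    intro w hw
    have hterm : ∀ σ : Equiv.Perm (Fin n),
        Equiv.Perm.sign σ • MultilinearMap.domDomCongr σ P w =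
          (List.ofFn fun i : Fin n => cliffordAlternate c c' i (w i)).prod := by
      intro σ
      have := prod_ofFn_perm (fun i a : Fin n => cliffordAlternate c c' i (w a))
        (fun i j hij a b hab => by
          rw [← hij]
          exact h.alternate_mul (hw hab) i) σ
      simp only [P, MultilinearMap.domDomCongr_apply, MultilinearMap.compLinearMap_apply,
        MultilinearMap.mkPiAlgebraFin_apply, this, smul_smul, Int.units_mul_self, one_smul]
    rw [MultilinearMap.alternatization_apply, Finset.sum_congr rfl fun σ _ => hterm σ]
    simp [Fintype.card_perm, Nat.cast_smul_eq_nsmul]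
  have hdet : MultilinearMap.alternatization P =
      (LinearMap.toSpanSingleton ℝ A (MultilinearMap.alternatization P e)).compAlternatingMap
        e.toBasis.det := by
    refine e.toBasis.ext_alternating fun v hv => ?_
    let σ := Equiv.ofBijective v (Finite.injective_iff_bijective.mp hv)
    have h₁ := (MultilinearMap.alternatization P).map_perm e σ
    have h₂ := e.toBasis.det.map_perm e σ
    change MultilinearMap.alternatization P (e ∘ σ) = _ at h₁
    change e.toBasis.det (e ∘ σ) = _ at h₂
    have hvσ : (fun i => e.toBasis (v i)) = e ∘ σ := by
      funext i
      simp [σ]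
    have h₃ : e.toBasis.det e = 1 := by
      simpa using e.toBasis.det_self
    rw [hvσ, h₁, LinearMap.compAlternatingMap_apply, h₂, h₃, LinearMap.toSpanSingleton_apply]
    rcases Int.units_eq_one_or (Equiv.Perm.sign σ) with hs | hs <;> simp [hs]
  have hfac : (n.factorial : ℝ) ≠ 0 := by positivity
  have := hP w hw
  rw [hdet, LinearMap.compAlternatingMap_apply, LinearMap.toSpanSingleton_apply,
    hP e fun a b hab => e.orthonormal.2 hab, smul_comm] at this
  exact (smul_right_injective A hfac this).symm

/-- For a family `v` orthogonal to `x`, the product of the `c' x * c (v i)` reduces to an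
alternating product. -/
theorem prod_conj_mul (h : IsCliffordPair c c')
    {m : ℕ} {x : V} (v : Fin (2 * m + 1) → V) (hv : ∀ i, inner ℝ x (v i) = 0) :
    (List.ofFn fun i => c' x * c (v i)).prod =
      (-inner ℝ x x) ^ m •
        (c' x * (List.ofFn fun i => cliffordAlternate c c' (i + 1) (v i)).prod) := by
  induction m with
  | zero => simp [cliffordAlternate]
  | succ m ih =>
    have key := ih (fun i => v i.succ.succ) fun i => hv _
    change (List.ofFn (n := 2 * m + 1 + 1 + 1) fun i => c' x * c (v i)).prod =
      (-inner ℝ x x) ^ (m + 1) • (c' x * (List.ofFn (n := 2 * m + 1 + 1 + 1)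
        fun i => cliffordAlternate c c' (i + 1) (v i)).prod)
    have hperiod : ∀ i, cliffordAlternate c c' (i + 1 + 1 + 1) = cliffordAlternate c c' (i + 1) := by
      intro i
      simp [cliffordAlternate, Nat.even_add_one]
    have hone : cliffordAlternate c c' 1 = c := by simp [cliffordAlternate]
    have htwo : cliffordAlternate c c' 2 = c' := by simp [cliffordAlternate]
    simp only [List.ofFn_succ (n := 2 * m + 1 + 1), List.ofFn_succ (n := 2 * m + 1),
      List.prod_cons, Fin.val_succ, Fin.val_zero, zero_add, Nat.reduceAdd, hperiod, key, hone, htwo]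
    rw [mul_smul_comm, mul_smul_comm, pow_succ, mul_smul, ← mul_assoc,
      h.mul_mul_of_inner_eq_zero _ (hv _)]
    generalize (List.ofFn fun i : Fin (2 * m + 1) =>
      cliffordAlternate c c' (↑i + 1) (v i.succ.succ)).prod = Q
    congr 1
    rw [neg_mul, mul_assoc _ (c x), ← mul_assoc (c x), h.symm.conj_mul_self]
    simp only [smul_mul_assoc, mul_smul_comm, one_mul, neg_smul, mul_assoc]

end IsCliffordPair

namespace IsCliffordPair

variable {c c' : V →ₗ[ℝ] A}

/-- For an orthogonal family `v` of odd size one of whose members is a multiple of `x`, the product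
of the `c' x * c (v a)`, in any order, is traceless: it anticommutes with each noncentral factor. -/
theorem trace_prod_eq_zero (h : IsCliffordPair c c')
    {W : Type*} [AddCommGroup W] [Module ℝ W] (τ : A →ₗ[ℝ] W)
    (hτ : ∀ a b, τ (a * b) = τ (b * a)) {p : ℕ} (hodd : Odd p) (hp : 1 < p) {x : V} (hx : x ≠ 0)
    (v : Fin p → V) (hv : ∀ a, v a ≠ 0) (hvv : Pairwise fun a b => inner ℝ (v a) (v b) = 0)
    (i : Fin p) {t : ℝ} (hi : v i = t • x) (σ : Equiv.Perm (Fin p)) :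
    τ (List.ofFn fun a => c' x * c (v (σ a))).prod = 0 := by
  have : Nontrivial (Fin p) := Fin.nontrivial_iff_two_le.mpr hp
  obtain ⟨b, hb⟩ := exists_ne i
  have ht : t ≠ 0 := by
    rintro rfl
    exact hv i (by simpa using hi)
  have horth : ∀ a, a ≠ i → inner ℝ x (v a) = 0 := by
    intro a ha
    have : inner ℝ (v i) (v a) = 0 := hvv ha.symm
    rw [hi, real_inner_smul_left] at this
    exact (mul_eq_zero.mp this).resolve_left ht
  set B := c' x * c (v b) with hB
  set P := (List.ofFn fun a => c' x * c (v (σ a))).prod with hP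
  let ε : Fin p → ℤ := fun a => -1 * ((if a = i then -1 else 1) * (if a = b then -1 else 1))
  have hε : ∀ a, B * (c' x * c (v a)) = ε a • (c' x * c (v a) * B) := by
    intro a
    by_cases hai : a = i
    · subst hai
      simp [ε, hb.symm, hi, h.conj_mul_self]
    · by_cases hab : a = b
      · subst hab
        simp [ε, hai, hB]
      · simp [ε, hai, hab, hB,
          h.anticomm_of_inner_eq_zero (horth b hb) (horth a hai) (hvv (Ne.symm hab))]
  have hprod : ∏ a, ε (σ a) = -1 := by
    rw [Equiv.prod_comp σ ε]
    simp only [ε, Finset.prod_mul_distrib]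
    simp [hodd.neg_one_pow]
  have hBP : B * P = -(P * B) := by
    rw [hP, mul_prod_ofFn_eq_sign_smul B _ (fun a => ε (σ a)) fun a => hε (σ a), hprod, neg_smul,
      one_smul]
  have hBB : B * B = -(inner ℝ (v b) (v b) * inner ℝ x x) • (1 : A) :=
    h.mul_self_of_inner_eq_zero (horth b hb)
  have hcyc : τ (B * P * B) = τ (P * (B * B)) := by
    rw [mul_assoc, hτ, mul_assoc]
  rw [hBP, neg_mul, mul_assoc, map_neg, neg_eq_iff_add_eq_zero, ← two_smul ℝ,
    smul_eq_zero_iff_right two_ne_zero, hBB, mul_smul_comm, mul_one, map_smul, smul_eq_zero] at hcyc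
  refine hcyc.resolve_left (neg_ne_zero.mpr (mul_ne_zero ?_ ?_))
  · exact inner_self_ne_zero.mpr (hv b)
  · exact inner_self_ne_zero.mpr hx

/-- The antisymmetrized trace of the products of the `c' x * c (v a)` is a multiple of the
determinant of `x, v₁, …, v_p`. -/
theorem sum_sign_trace (h : IsCliffordPair c c')
    {W : Type*} [AddCommGroup W] [Module ℝ W] (τ : A →ₗ[ℝ] W)
    (hτ : ∀ a b, τ (a * b) = τ (b * a)) {m : ℕ} (hm : 0 < m)
    (e : OrthonormalBasis (Fin (2 * m + 1 + 1)) ℝ V) {x : V} (hx : x ≠ 0)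
    (v : Fin (2 * m + 1) → V) :
    ∑ σ : Equiv.Perm (Fin (2 * m + 1)),
        Equiv.Perm.sign σ • τ (List.ofFn fun a => c' x * c (v (σ a))).prod =
      e.toBasis.det (vecCons x v) • ((2 * m + 1).factorial : ℝ) • (-inner ℝ x x) ^ m •
        τ (List.ofFn fun i : Fin (2 * m + 1 + 1) => cliffordAlternate c c' i (e i)).prod := by
  let ω : V [⋀^Fin (2 * m + 1)]→ₗ[ℝ] W := MultilinearMap.alternatization
    (τ.compMultilinearMap ((MultilinearMap.mkPiAlgebraFin ℝ (2 * m + 1) A).compLinearMap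
      fun _ => (LinearMap.mulLeft ℝ (c' x)).comp c))
  have hω : ∀ v, ω v = ∑ σ : Equiv.Perm (Fin (2 * m + 1)),
      Equiv.Perm.sign σ • τ (List.ofFn fun a => c' x * c (v (σ a))).prod := by
    intro v
    simp [ω, MultilinearMap.alternatization_apply]
  let K : W := ((2 * m + 1).factorial : ℝ) • (-inner ℝ x x) ^ m •
    τ (List.ofFn fun i : Fin (2 * m + 1 + 1) => cliffordAlternate c c' i (e i)).prod
  let η : V [⋀^Fin (2 * m + 1)]→ₗ[ℝ] W :=
    (LinearMap.toSpanSingleton ℝ W K).compAlternatingMap (e.toBasis.det.curryLeft x)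
  have hη : ∀ v, η v = e.toBasis.det (vecCons x v) • K := fun v => rfl
  suffices hωη : ω = η by
    rw [← hω, hωη, hη]
  have : FiniteDimensional ℝ V := e.toBasis.finiteDimensional_of_finite
  have hnorm : ‖x‖ ≠ 0 := norm_ne_zero_iff.mpr hx
  obtain ⟨b, hb⟩ := Orthonormal.exists_orthonormalBasis_extension_of_card_eq (𝕜 := ℝ)
    (ι := Fin (2 * m + 1 + 1)) (Module.finrank_eq_card_basis e.toBasis)
    (v := fun _ => ‖x‖⁻¹ • x) (s := {0}) (by
      refine ⟨fun _ => ?_, fun i j hij => (hij (Subsingleton.elim i j)).elim⟩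
      simp [norm_smul, hnorm])
  replace hb : b 0 = ‖x‖⁻¹ • x := hb 0 rfl
  have hxb : x = ‖x‖ • b 0 := by rw [hb, smul_smul, mul_inv_cancel₀ hnorm, one_smul]
  refine b.toBasis.ext_alternating fun u hu => ?_
  simp only [OrthonormalBasis.coe_toBasis]
  have horth : Pairwise fun i j => inner ℝ (b (u i)) (b (u j)) = 0 :=
    fun i j hij => b.orthonormal.2 (hu.ne hij)
  by_cases hzero : ∃ i, u i = 0
  · obtain ⟨i, hi⟩ := hzero
    rw [hω, Finset.sum_eq_zero fun σ _ => by
      rw [h.trace_prod_eq_zero τ hτ ⟨m, rfl⟩ (by lia) hx (fun i => b (u i))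
        (fun a => b.orthonormal.ne_zero _) horth i (by simp only [hi, hb]; rfl) σ, smul_zero]]
    have hdet : e.toBasis.det.curryLeft (b 0) (fun i => b (u i)) = 0 :=
      e.toBasis.det.map_eq_zero_of_eq _ (i := 0) (j := i.succ) (by simp [hi])
        (Fin.succ_ne_zero i).symm
    have hdet' : e.toBasis.det.curryLeft x (fun i => b (u i)) = 0 := by
      rw [hxb, map_smul, AlternatingMap.smul_apply, hdet, smul_zero]
    rw [hη]
    rw [AlternatingMap.curryLeft_apply_apply] at hdet'
    rw [hdet', zero_smul]
  · push Not at hzero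
    have hxu : ∀ i, inner ℝ x (b (u i)) = 0 := by
      intro i
      rw [hxb, real_inner_smul_left, b.orthonormal.2 (hzero i).symm, mul_zero]
    have hterm : ∀ σ : Equiv.Perm (Fin (2 * m + 1)),
        Equiv.Perm.sign σ • τ (List.ofFn fun a => c' x * c (b (u (σ a)))).prod =
          τ (List.ofFn fun a => c' x * c (b (u a))).prod := by
      intro σ
      rw [prod_ofFn_perm (fun _ a => c' x * c (b (u a)))
        (fun _ _ _ i j hij => h.anticomm_of_inner_eq_zero (hxu i) (hxu j) (horth hij)) σ]
      rcases Int.units_eq_one_or (Equiv.Perm.sign σ) with hs | hs <;> simp [hs]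
    have hcons : c' x * (List.ofFn fun i : Fin (2 * m + 1) =>
          cliffordAlternate c c' (i + 1) (b (u i))).prod =
        (List.ofFn fun i : Fin (2 * m + 1 + 1) =>
          cliffordAlternate c c' i (vecCons x (fun i => b (u i)) i)).prod := by
      rw [List.ofFn_succ, List.prod_cons]
      simp [cliffordAlternate]
    have hpair : Pairwise fun i j => inner ℝ (vecCons x (fun i => b (u i)) i)
        (vecCons x (fun i => b (u i)) j) = 0 := by
      intro i j hij
      cases i using Fin.cases with
      | zero =>
        cases j using Fin.cases with
        | zero => exact (hij rfl).elim
        | succ j => simpa using hxu j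
      | succ i =>
        cases j using Fin.cases with
        | zero => simpa [real_inner_comm] using hxu i
        | succ j => simpa using horth fun hij' => hij (by rw [hij'])
    rw [hω, hη, Finset.sum_congr rfl fun σ _ => hterm σ, h.prod_conj_mul _ hxu, hcons,
      h.prod_alternate_eq_det_smul e _ hpair]
    simp only [Finset.sum_const, Finset.card_univ, Fintype.card_perm, Fintype.card_fin, map_smul, K,
      ← Nat.cast_smul_eq_nsmul ℝ, smul_smul]
    congr 1
    ring

end IsCliffordPair
end CliffordPairs

/-- The determinant of `x` followed by all standard basis vectors but the `j`-th. -/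
theorem det_basisFun_vecCons_succAbove {p : ℕ} (x : EuclideanSpace ℝ (Fin (p + 1)))
    (j : Fin (p + 1)) :
    (EuclideanSpace.basisFun (Fin (p + 1)) ℝ).toBasis.det
      (vecCons x fun a => EuclideanSpace.basisFun (Fin (p + 1)) ℝ (j.succAbove a)) =
      (-1) ^ (j : ℕ) * x j := by
  rw [Module.Basis.det_apply, ← det_transpose, det_succ_row_zero, Finset.sum_eq_single j]
  · have hsub : submatrix ((EuclideanSpace.basisFun (Fin (p + 1)) ℝ).toBasis.toMatrix
        (vecCons x fun a => EuclideanSpace.basisFun (Fin (p + 1)) ℝ (j.succAbove a)))ᵀ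
        Fin.succ j.succAbove = 1 := by
      ext a b
      simp [Module.Basis.toMatrix_apply, Matrix.one_apply, eq_comm]
    rw [hsub, det_one, mul_one]
    simp [Module.Basis.toMatrix_apply]
  · intro i _ hij
    obtain ⟨a, ha⟩ := Fin.exists_succAbove_eq hij
    rw [det_eq_zero_of_row_eq_zero a, mul_zero]
    intro b
    simp [Module.Basis.toMatrix_apply, ha, Fin.succAbove_ne]
  · simp

section CliffordMatrices

variable {p N : ℕ} (E : Fin p → Matrix (Fin N) (Fin N) ℂ)

/-- The linear map `v ↦ v₀ + s (v₁ E₁ + ⋯ + v_p E_p)`. -/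
noncomputable def cliffordMap (s : ℝ) :
    EuclideanSpace ℝ (Fin (p + 1)) →ₗ[ℝ] Matrix (Fin N) (Fin N) ℂ where
  toFun v := v 0 • 1 + s • ∑ i : Fin p, v i.succ • E i
  map_add' v w := by
    simp only [PiLp.add_apply, add_smul, Finset.sum_add_distrib, smul_add]
    abel
  map_smul' t v := by
    simp only [PiLp.smul_apply, smul_eq_mul, mul_smul, smul_add, Finset.smul_sum, RingHom.id_apply,
      smul_comm s t]

theorem cliffordMap_apply (s : ℝ) (v : EuclideanSpace ℝ (Fin (p + 1))) :
    cliffordMap E s v = v 0 • 1 + s • ∑ i : Fin p, v i.succ • E i := rfl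

theorem cliffordMap_single (s : ℝ) (j : Fin (p + 1)) :
    cliffordMap E s (EuclideanSpace.single j 1) =
      (Fin.cons 1 fun i => s • E i : Fin (p + 1) → Matrix (Fin N) (Fin N) ℂ) j := by
  cases j using Fin.cases with
  | zero => simp [cliffordMap_apply]
  | succ j => simp [cliffordMap_apply, ite_smul, (Fin.succ_ne_zero j).symm]

variable {E}

theorem isCliffordPair_cliffordMap
    (hcliff : ∀ i j, E i * E j + E j * E i
      = if i = j then (-2 : ℂ) • (1 : Matrix (Fin N) (Fin N) ℂ) else 0) :
    IsCliffordPair (cliffordMap E 1) (cliffordMap E (-1)) := by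
  have hsum : ∀ v w : Fin p → ℝ, (∑ i, v i • E i) * (∑ i, w i • E i) +
      (∑ i, w i • E i) * (∑ i, v i • E i) = (-2 * ∑ i, v i * w i) • 1 := by
    intro v w
    have h2 : (-2 : ℂ) • (1 : Matrix (Fin N) (Fin N) ℂ) = (-2 : ℝ) • 1 := by
      rw [← Complex.coe_smul]
      norm_num
    simp only [Finset.sum_mul_sum]
    rw [Finset.sum_comm (f := fun i j => w i • E i * v j • E j), ← Finset.sum_add_distrib,
      Finset.mul_sum, Finset.sum_smul]
    refine Finset.sum_congr rfl fun i _ => ?_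
    rw [← Finset.sum_add_distrib]
    have hterm : ∀ j, v i • E i * w j • E j + w j • E j * v i • E i =
        if i = j then (-2 * (v i * w j)) • 1 else 0 := by
      intro j
      rw [smul_mul_smul_comm, smul_mul_smul_comm, mul_comm (w j), ← smul_add, hcliff, h2]
      split_ifs
      · rw [smul_smul, mul_comm]
      · rw [smul_zero]
    rw [Finset.sum_congr rfl fun j _ => hterm j]
    simp
  have hinner : ∀ v w : EuclideanSpace ℝ (Fin (p + 1)),
      inner ℝ v w = v 0 * w 0 + ∑ i : Fin p, v i.succ * w i.succ := by
    intro v w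
    rw [PiLp.inner_apply, Fin.sum_univ_succ]
    simp [mul_comm]
  have hpair : ∀ s : ℝ, s * s = 1 → ∀ v w, cliffordMap E (-s) v * cliffordMap E s w +
      cliffordMap E (-s) w * cliffordMap E s v = (2 * inner ℝ v w) • 1 := by
    intro s hs v w
    have hs' := hsum (fun i => v i.succ) (fun i => w i.succ)
    rw [hinner, mul_add, add_smul]
    rw [show (2 * ∑ i : Fin p, v i.succ * w i.succ) • (1 : Matrix (Fin N) (Fin N) ℂ) =
      -((-2 * ∑ i : Fin p, v i.succ * w i.succ) • 1) by rw [← neg_smul]; ring_nf, ← hs']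
    simp only [cliffordMap_apply]
    generalize (∑ i : Fin p, v i.succ • E i) = X
    generalize (∑ i : Fin p, w i.succ • E i) = Y
    simp only [add_mul, mul_add, smul_mul_smul_comm, mul_one, one_mul, neg_mul, hs]
    module
  exact ⟨hpair 1 (by norm_num), by simpa using hpair (-1) (by norm_num)⟩

end CliffordMatrices

/-- let `p = 2k-1` (`k ≥ 2`), `E₁,…,E_p` skew-adjoint Clifford
matrices in `M_N(ℂ)`. For `0 ≠ x = (x₀,…,x_p) ∈ ℝ^{p+1}`, the matrix
`f(x) = x₀·I + Σⱼ xⱼ Eⱼ` is invertible, and for every `j ∈ {0,…,p}`, with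
`D₀ = I`, `Dᵢ = Eᵢ` and `(i₁ < … < i_p)` the increasing enumeration
`j.succAbove` of `{0,…,p} \ {j}`,
`Σ_{σ ∈ S_p} sgn σ · tr(f⁻¹ D_{i_{σ(1)}} ⋯ f⁻¹ D_{i_{σ(p)}})
  = (-1)^j x_j |x|^{-p-1} p! tr(E₁⋯E_p)`. -/
theorem stmt_9 (k : ℕ) (hk : 2 ≤ k) (p : ℕ) (hp : p = 2 * k - 1)
    (N : ℕ) (hN : 1 ≤ N) (E : Fin p → Matrix (Fin N) (Fin N) ℂ)
    (hskew : ∀ i, (E i)ᴴ = -(E i))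
    (hcliff : ∀ i j, E i * E j + E j * E i
      = if i = j then (-2 : ℂ) • (1 : Matrix (Fin N) (Fin N) ℂ) else 0)
    (x : Fin (p + 1) → ℝ) (hx : x ≠ 0)
    (f : Matrix (Fin N) (Fin N) ℂ)
    (hf : f = (x 0 : ℂ) • (1 : Matrix (Fin N) (Fin N) ℂ)
      + ∑ i : Fin p, (x i.succ : ℂ) • E i)
    (D : Fin (p + 1) → Matrix (Fin N) (Fin N) ℂ)
    (hD : D = Fin.cons (1 : Matrix (Fin N) (Fin N) ℂ) E) :
    IsUnit f ∧
    ∀ j : Fin (p + 1),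
      ∑ σ : Equiv.Perm (Fin p), ((Equiv.Perm.sign σ : ℤ) : ℂ) *
          (List.ofFn fun a : Fin p => f⁻¹ * D (j.succAbove (σ a))).prod.trace
        = (-1 : ℂ) ^ (j : ℕ) * (x j : ℂ)
          * (((∑ i, x i ^ 2 : ℝ) ^ (-((p : ℝ) + 1) / 2) : ℝ) : ℂ)
          * (Nat.factorial p : ℂ) * (List.ofFn E).prod.trace := by
  obtain ⟨m, hm, rfl⟩ : ∃ m, 0 < m ∧ p = 2 * m + 1 := ⟨k - 1, by lia, by lia⟩
  let X : EuclideanSpace ℝ (Fin (2 * m + 1 + 1)) := WithLp.toLp 2 x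
  have hX : X ≠ 0 := fun h0 => hx (by simpa [X] using h0)
  let e := EuclideanSpace.basisFun (Fin (2 * m + 1 + 1)) ℝ
  have hpair := isCliffordPair_cliffordMap hcliff
  set r : ℝ := ∑ i, x i ^ 2 with hr
  have hXX : inner ℝ X X = r := by
    rw [PiLp.inner_apply]
    simp [X, hr, sq]
  have hr0 : 0 < r := by
    rw [← hXX]
    exact real_inner_self_pos.mpr hX
  have hfX : f = cliffordMap E 1 X := by
    simp [hf, cliffordMap_apply, X, Complex.coe_smul]
  have hDe : ∀ j, D j = cliffordMap E 1 (e j) := by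
    intro j
    simp [hD, e, cliffordMap_single]
  have hleft : (r⁻¹ • cliffordMap E (-1) X) * f = 1 := by
    rw [hfX, smul_mul_assoc, hpair.conj_mul_self, hXX, smul_smul, inv_mul_cancel₀ hr0.ne', one_smul]
  refine ⟨IsUnit.of_mul_eq_one_right _ hleft, fun j => ?_⟩
  have hscale : ∀ σ : Equiv.Perm (Fin (2 * m + 1)),
      (List.ofFn fun a => f⁻¹ * D (j.succAbove (σ a))).prod = r⁻¹ ^ (2 * m + 1) •
        (List.ofFn fun a => cliffordMap E (-1) X * cliffordMap E 1 (e (j.succAbove (σ a)))).prod := by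
    intro σ
    have := (MultilinearMap.mkPiAlgebraFin ℝ (2 * m + 1) (Matrix (Fin N) (Fin N) ℂ)).map_smul_univ
      (fun _ => r⁻¹) fun a => cliffordMap E (-1) X * cliffordMap E 1 (e (j.succAbove (σ a)))
    simp only [MultilinearMap.mkPiAlgebraFin_apply, Finset.prod_const, Finset.card_univ,
      Fintype.card_fin] at this
    rw [← this, Matrix.inv_eq_left_inv hleft]
    simp only [smul_mul_assoc, hDe]
  have hmain := hpair.sum_sign_trace (Matrix.traceLinearMap (Fin N) ℝ ℂ)
    (fun a b => Matrix.trace_mul_comm a b) hm e hX fun a => e (j.succAbove a)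
  have hstd : (List.ofFn fun i : Fin (2 * m + 1 + 1) =>
      cliffordAlternate (cliffordMap E 1) (cliffordMap E (-1)) i (e i)).prod =
      (-1) ^ m * (List.ofFn E).prod := by
    rw [← prod_ofFn_neg_one_pow, List.ofFn_succ, List.prod_cons]
    have hzero : cliffordAlternate (cliffordMap E 1) (cliffordMap E (-1)) 0 (e 0) = 1 := by
      simp [cliffordAlternate, e, cliffordMap_single]
    have hsucc : ∀ i : Fin (2 * m + 1),
        cliffordAlternate (cliffordMap E 1) (cliffordMap E (-1)) (i + 1) (e i.succ) =
          (-1) ^ (i : ℕ) * E i := by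
      intro i
      rcases Nat.even_or_odd (i : ℕ) with hi | hi
      · simp [cliffordAlternate, e, cliffordMap_single, Nat.even_add_one, hi]
      · simp [cliffordAlternate, e, cliffordMap_single, Nat.even_add_one,
          Nat.not_even_iff_odd.mpr hi, hi.neg_one_pow]
    simp only [Fin.val_zero, Fin.val_succ, hzero, hsucc, one_mul]
  have hpow : r ^ (-(((2 * m + 1 : ℕ) : ℝ) + 1) / 2) = (r ^ (m + 1))⁻¹ := by
    rw [← Real.rpow_natCast, ← Real.rpow_neg hr0.le]
    congr 1
    push_cast
    ring
  have hsgn : ((-1 : Matrix (Fin N) (Fin N) ℂ) ^ m * (List.ofFn E).prod).trace =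
      (-1) ^ m * (List.ofFn E).prod.trace := by
    rcases Nat.even_or_odd m with h | h <;> simp [h.neg_one_pow]
  have hcoef : r⁻¹ ^ (2 * m + 1) * ((-r) ^ m * (-1) ^ m) = (r ^ (m + 1))⁻¹ := by
    rw [← mul_pow, neg_mul_neg, mul_one, inv_pow]
    field_simp
    ring
  rw [hstd, traceLinearMap_apply, hsgn, hXX, det_basisFun_vecCons_succAbove] at hmain
  have hcoefC : ((r : ℂ)⁻¹ ^ (2 * m + 1) * ((-r) ^ m * (-1) ^ m)) = ((r ^ (m + 1))⁻¹ : ℝ) := by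
    rw [← hcoef]
    push_cast
    rfl
  calc
    _ = (r : ℂ)⁻¹ ^ (2 * m + 1) * ∑ σ : Equiv.Perm (Fin (2 * m + 1)), Equiv.Perm.sign σ •
        traceLinearMap (Fin N) ℝ ℂ (List.ofFn fun a =>
          cliffordMap E (-1) X * cliffordMap E 1 (e (j.succAbove (σ a)))).prod := by
      rw [Finset.mul_sum]
      refine Finset.sum_congr rfl fun σ _ => ?_
      rw [hscale, Matrix.trace_smul, Complex.real_smul, Units.smul_def, zsmul_eq_mul,
        traceLinearMap_apply]
      push_cast
      ring
    _ = _ := by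
      rw [hmain, hpow, ← hcoefC]
      simp only [Complex.real_smul]
      push_cast
      simp only [X]
      ring
end
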